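/- For any r ≥ 0 and s ∈ ℝ, the sublevel Delaunay–Čech complex collapses to the sublevel Delaunay complex: DelČech_{r,s}(γ) ↘ Del_{r,s}(γ); in particular the inclusion Del_{r,s}(γ) ↪ DelČech_{r,s}(γ) is a homotopy equivalence. -/

import Mathlib

open Finset

variable {d n : ℕ}

def GenPos (x : Fin n → EuclideanSpace ℝ (Fin d)) : Prop :=
  ∀ s : Finset (Fin n), s.Nonempty → s.card ≤ d + 1 →
    (AffineIndependent ℝ (fun i : s => x i)) ∧
    ∀ (c : EuclideanSpace ℝ (Fin d)) (r : ℝ),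
      ((∀ i ∈ s, dist (x i) c = r) ∧
        ∀ (c' : EuclideanSpace ℝ (Fin d)) (r' : ℝ),
          (∀ i ∈ s, dist (x i) c' = r') → r ≤ r') →
      ∀ j, j ∉ s → dist (x j) c ≠ r

/-- Radii of spheres witnessing the incremental Delaunay condition for `σ`; the infimum is
the incremental Delaunay radius `ρ_σ`. -/
def incrSet (x : Fin n → EuclideanSpace ℝ (Fin d)) (σ : Finset (Fin n)) : Set ℝ :=
  {r | ∃ h : σ.Nonempty, ∃ c : EuclideanSpace ℝ (Fin d),
    (∀ i ∈ σ.erase (σ.max' h), dist (x i) c = r) ∧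
    dist (x (σ.max' h)) c ≤ r ∧
    ∀ i : Fin n, i < σ.max' h → r ≤ dist (x i) c}

/-- Radii of balls enclosing `σ`; the infimum is the minimum enclosing ball radius `r_σ`. -/
def mebSet (x : Fin n → EuclideanSpace ℝ (Fin d)) (σ : Finset (Fin n)) : Set ℝ :=
  {r | ∃ c : EuclideanSpace ℝ (Fin d), ∀ i ∈ σ, dist (x i) c ≤ r}

/-- `σ ∈ Del_{r,s}(γ)`: `σ ∈ I(X)`, `ρ_σ ≤ r` and `γ(max σ) ≤ s`. -/
def DelBiMem (x : Fin n → EuclideanSpace ℝ (Fin d)) (γ : Fin n → ℝ) (r s : ℝ)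
    (σ : Finset (Fin n)) : Prop :=
  (incrSet x σ).Nonempty ∧ sInf (incrSet x σ) ≤ r ∧
    ∃ h : σ.Nonempty, γ (σ.max' h) ≤ s

/-- `σ ∈ DelČech_{r,s}(γ)`: `σ ∈ I(X)`, `r_σ ≤ r` and `γ(max σ) ≤ s`. -/
def DelCechBiMem (x : Fin n → EuclideanSpace ℝ (Fin d)) (γ : Fin n → ℝ) (r s : ℝ)
    (σ : Finset (Fin n)) : Prop :=
  (incrSet x σ).Nonempty ∧ sInf (mebSet x σ) ≤ r ∧
    ∃ h : σ.Nonempty, γ (σ.max' h) ≤ s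

/-- An elementary (free-face) collapse between abstract simplicial complexes. -/
def ElemCollapse (K L : Set (Finset (Fin n))) : Prop :=
  ∃ σ τ : Finset (Fin n), σ ∈ K ∧ τ ∈ K ∧ σ ⊂ τ ∧
    (∀ υ ∈ K, σ ⊂ υ → υ = τ) ∧ L = K \ {σ, τ}

/-- `K ↘ L`: a finite sequence of elementary collapses from `K` to `L`. -/
def CollapsesTo (K L : Set (Finset (Fin n))) : Prop :=
  Relation.ReflTransGen (fun A B => ElemCollapse A B) K L

/-- The geometric realization of an abstract simplicial complex on the vertex set `Fin n`,
realized on the standard basis vectors of `ℝ^n`. -/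
def spaceOf (K : Set (Finset (Fin n))) : Set (EuclideanSpace ℝ (Fin n)) :=
  ⋃ σ ∈ K, convexHull ℝ ((fun i : Fin n => EuclideanSpace.single i (1 : ℝ)) '' ↑σ)


/-- An abstract simplicial complex: nonempty simplices, closed under nonempty faces. -/
def IsComplex (K : Set (Finset (Fin n))) : Prop :=
  ∀ τ ∈ K, τ.Nonempty ∧ ∀ σ ⊆ τ, σ.Nonempty → σ ∈ K

lemma ElemCollapse.isComplex {K L : Set (Finset (Fin n))} (hK : IsComplex K)
    (h : ElemCollapse K L) : IsComplex L := by
  obtain ⟨σ, τ, hσ, hτ, hστ, hfree, rfl⟩ := h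
  intro υ hυ
  refine ⟨(hK υ hυ.1).1, fun ω hω hne => ⟨(hK υ hυ.1).2 ω hω hne, ?_⟩⟩
  have hυ' : υ ≠ σ ∧ υ ≠ τ := by simpa using hυ.2
  rintro (rfl | rfl)
  · exact hυ'.2 (hfree υ hυ.1 (hω.lt_of_ne hυ'.1.symm))
  · exact hυ'.2 (hfree υ hυ.1 (hστ.trans_subset hω))

lemma mem_spaceOf {K : Set (Finset (Fin n))} {p : EuclideanSpace ℝ (Fin n)} :
    p ∈ spaceOf K ↔ ∃ σ ∈ K, (∀ i, 0 ≤ p i) ∧ ∑ i, p i = 1 ∧ ∀ i ∉ σ, p i = 0 := by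
  simp only [spaceOf, Set.mem_iUnion, exists_prop]
  refine exists_congr fun σ => and_congr_right fun _ => ⟨fun hp => ?_, ?_⟩
  · have hconv : Convex ℝ {q : EuclideanSpace ℝ (Fin n) |
        (∀ i, 0 ≤ q i) ∧ ∑ i, q i = 1 ∧ ∀ i ∉ σ, q i = 0} := by
      rintro q ⟨h1, h2, h3⟩ q' ⟨h1', h2', h3'⟩ a b ha hb hab
      refine ⟨fun i => ?_, ?_, fun i hi => ?_⟩
      · have := mul_nonneg ha (h1 i)
        have := mul_nonneg hb (h1' i)
        simp only [PiLp.add_apply, PiLp.smul_apply, smul_eq_mul]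
        positivity
      · simp [Finset.sum_add_distrib, ← Finset.mul_sum, h2, h2', hab]
      · simp [h3 i hi, h3' i hi]
    refine convexHull_min ?_ hconv hp
    rintro _ ⟨i, hi, rfl⟩
    refine ⟨fun j => ?_, by simp, fun j hj => ?_⟩
    · by_cases h : j = i <;> simp [h]
    · have : j ≠ i := fun h => hj (h ▸ hi)
      simp [this]
  · rintro ⟨h1, h2, h3⟩
    have hsum : p = ∑ i ∈ σ, p i • EuclideanSpace.single i (1 : ℝ) := by
      ext j
      by_cases hj : j ∈ σ <;> simp [Pi.single_apply, hj, h3]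
    have hone : ∑ i ∈ σ, p i = 1 := by
      rw [← h2]
      exact Finset.sum_subset (Finset.subset_univ _) fun i _ hi => h3 i hi
    rw [hsum]
    exact (convex_convexHull ℝ _).sum_mem (fun i _ => h1 i) hone fun i hi =>
      subset_convexHull ℝ _ ⟨i, hi, rfl⟩

/-- Move mass from the vertices of `σ` to the vertex `u`, at equal rates; at time `1` the smallest
barycentric coordinate over `σ` has become zero. -/
noncomputable def pushMap (σ : Finset (Fin n)) (hσ : σ.Nonempty) (u : Fin n) (t : ℝ)
    (p : EuclideanSpace ℝ (Fin n)) : EuclideanSpace ℝ (Fin n) :=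
  p + (t * σ.inf' hσ fun i => p i) •
    ((σ.card : ℝ) • EuclideanSpace.single u (1 : ℝ) -
      ∑ i ∈ σ, EuclideanSpace.single i (1 : ℝ))

section pushMap

variable {σ : Finset (Fin n)} {hσ : σ.Nonempty} {u : Fin n} {t : ℝ}
  {p : EuclideanSpace ℝ (Fin n)}

lemma pushMap_apply (i : Fin n) :
    pushMap σ hσ u t p i = p i + (t * σ.inf' hσ fun i => p i) *
      ((if i = u then (σ.card : ℝ) else 0) - if i ∈ σ then 1 else 0) := by
  simp [pushMap, Pi.single_apply]

lemma continuous_pushMap (hσ : σ.Nonempty) :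
    Continuous fun q : ℝ × EuclideanSpace ℝ (Fin n) => pushMap σ hσ u q.1 q.2 := by
  have : Continuous fun q : ℝ × EuclideanSpace ℝ (Fin n) => σ.inf' hσ fun i => q.2 i :=
    Continuous.finset_inf'_apply hσ fun i _ => by fun_prop
  unfold pushMap
  fun_prop

lemma pushMap_zero : pushMap σ hσ u 0 p = p := by
  simp [pushMap]

lemma pushMap_eq_self (h : (σ.inf' hσ fun i => p i) = 0) : pushMap σ hσ u t p = p := by
  simp [pushMap, h]

lemma pushMap_nonneg (hu : u ∉ σ) (ht0 : 0 ≤ t) (ht1 : t ≤ 1) (hp : ∀ i, 0 ≤ p i) (i : Fin n) :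
    0 ≤ pushMap σ hσ u t p i := by
  have hm : 0 ≤ σ.inf' hσ fun i => p i := (Finset.le_inf'_iff _ _).2 fun i _ => hp i
  rw [pushMap_apply]
  by_cases hi : i ∈ σ
  · have : i ≠ u := fun h => hu (h ▸ hi)
    have h1 : (σ.inf' hσ fun i => p i) ≤ p i := Finset.inf'_le _ hi
    simp only [this, hi, if_true, if_false]
    nlinarith
  · simp only [hi, if_false, sub_zero]
    have := hp i
    split_ifs <;> positivity

lemma sum_pushMap : ∑ i, pushMap σ hσ u t p i = ∑ i, p i := by
  simp [pushMap_apply, Finset.sum_add_distrib, ← Finset.mul_sum]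

lemma pushMap_eq_zero {i : Fin n} (hi : i ∉ insert u σ) (hp : p i = 0) :
    pushMap σ hσ u t p i = 0 := by
  rw [Finset.mem_insert, not_or] at hi
  simp [pushMap_apply, hi.1, hi.2, hp]

lemma exists_pushMap_one_eq_zero (hσ : σ.Nonempty) (hu : u ∉ σ) :
    ∃ i ∈ σ, pushMap σ hσ u 1 p i = 0 := by
  obtain ⟨i, hi, h⟩ := Finset.exists_mem_eq_inf' hσ fun i => p i
  have : i ≠ u := fun h => hu (h ▸ hi)
  exact ⟨i, hi, by simp [pushMap_apply, this, hi, h]⟩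

end pushMap

/-- The inclusion `|L| ↪ |K|` exists and is a homotopy equivalence. -/
def InclusionHomotopyEquiv (K L : Set (Finset (Fin n))) : Prop :=
  ∃ hsub : spaceOf L ⊆ spaceOf K, ∃ e : ContinuousMap.HomotopyEquiv (spaceOf L) (spaceOf K),
    e.toFun = ⟨Set.inclusion hsub, continuous_inclusion hsub⟩

lemma InclusionHomotopyEquiv.refl (K : Set (Finset (Fin n))) : InclusionHomotopyEquiv K K :=
  ⟨subset_rfl, ContinuousMap.HomotopyEquiv.refl _, rfl⟩

lemma InclusionHomotopyEquiv.trans {K L M : Set (Finset (Fin n))}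
    (h₁ : InclusionHomotopyEquiv K L) (h₂ : InclusionHomotopyEquiv L M) :
    InclusionHomotopyEquiv K M := by
  obtain ⟨hs₁, e₁, he₁⟩ := h₁
  obtain ⟨hs₂, e₂, he₂⟩ := h₂
  refine ⟨hs₂.trans hs₁, e₂.trans e₁, ?_⟩
  change e₁.toFun.comp e₂.toFun = _
  rw [he₁, he₂]
  rfl

lemma IsComplex.mem_spaceOf_diff_or_forall_eq_zero {K : Set (Finset (Fin n))} (hK : IsComplex K)
    {σ τ : Finset (Fin n)} (hσ : σ.Nonempty) (hστ : σ ⊂ τ) (hfree : ∀ υ ∈ K, σ ⊂ υ → υ = τ)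
    {p : EuclideanSpace ℝ (Fin n)} (hp : p ∈ spaceOf K) :
    (p ∈ spaceOf (K \ {σ, τ}) ∧ (σ.inf' hσ fun i => p i) = 0) ∨ ∀ i ∉ τ, p i = 0 := by
  obtain ⟨υ, hυ, h0, h1, hz⟩ := mem_spaceOf.1 hp
  set S : Finset (Fin n) := Finset.univ.filter fun i => p i ≠ 0 with hS
  have hmem : ∀ i, i ∈ S ↔ p i ≠ 0 := by simp [hS]
  have hSne : S.Nonempty := by
    by_contra h
    rw [Finset.not_nonempty_iff_eq_empty] at h
    have : ∀ i, p i = 0 := fun i => by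
      by_contra hi
      simpa [h] using (hmem i).2 hi
    simp [this] at h1
  have hSK : S ∈ K := (hK υ hυ).2 S (fun i hi => by
    by_contra h
    exact (hmem i).1 hi (hz i h)) hSne
  by_cases hsub : σ ⊆ S
  · right
    intro i hi
    by_contra h
    rcases hsub.eq_or_ssubset with heq | hss
    · exact hi (hστ.subset (heq ▸ (hmem i).2 h))
    · exact hi (hfree S hSK hss ▸ (hmem i).2 h)
  · left
    refine ⟨mem_spaceOf.2 ⟨S, ⟨hSK, ?_⟩, h0, h1, fun i hi => ?_⟩, ?_⟩
    · rintro (h | h)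
      · exact hsub h.ge
      · exact hsub (hστ.subset.trans_eq (Set.mem_singleton_iff.1 h).symm)
    · by_contra h
      exact hi ((hmem i).2 h)
    · obtain ⟨i, hi, hiS⟩ := Finset.not_subset.1 hsub
      have : p i = 0 := by
        by_contra h
        exact hiS ((hmem i).2 h)
      exact le_antisymm (this ▸ Finset.inf'_le (fun i => p i) hi)
        ((Finset.le_inf'_iff _ _).2 fun i _ => h0 i)

lemma ElemCollapse.inclusionHomotopyEquiv {K L : Set (Finset (Fin n))} (hK : IsComplex K)
    (h : ElemCollapse K L) : InclusionHomotopyEquiv K L := by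
  obtain ⟨σ, τ, hσK, hτK, hστ, hfree, rfl⟩ := h
  have hσ := (hK σ hσK).1
  obtain ⟨u, huτ, hu⟩ := Finset.exists_of_ssubset hστ
  have hτ : insert u σ = τ := by
    have hsub : insert u σ ⊆ τ := Finset.insert_subset huτ hστ.subset
    exact hfree _ ((hK τ hτK).2 _ hsub (Finset.insert_nonempty _ _)) (Finset.ssubset_insert hu)
  have hsub : spaceOf (K \ {σ, τ}) ⊆ spaceOf K := fun p hp => by
    obtain ⟨υ, hυ, h⟩ := mem_spaceOf.1 hp
    exact mem_spaceOf.2 ⟨υ, hυ.1, h⟩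
  have hcases := fun {p} (hp : p ∈ spaceOf K) =>
    hK.mem_spaceOf_diff_or_forall_eq_zero hσ hστ hfree hp
  have hmemK : ∀ t ∈ Set.Icc (0 : ℝ) 1, ∀ p ∈ spaceOf K, pushMap σ hσ u t p ∈ spaceOf K := by
    intro t ht p hp
    obtain ⟨υ, -, h0, h1, -⟩ := mem_spaceOf.1 hp
    rcases hcases hp with ⟨-, hm⟩ | hz
    · rwa [pushMap_eq_self hm]
    · exact mem_spaceOf.2 ⟨τ, hτK, pushMap_nonneg hu ht.1 ht.2 h0, sum_pushMap.trans h1,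
        fun i hi => pushMap_eq_zero (hτ ▸ hi) (hz i hi)⟩
  have hmemL : ∀ p ∈ spaceOf K, pushMap σ hσ u 1 p ∈ spaceOf (K \ {σ, τ}) := by
    intro p hp
    rcases hcases (hmemK 1 (by simp) p hp) with h | hz
    · exact h.1
    obtain ⟨υ, -, h0, h1, -⟩ := mem_spaceOf.1 hp
    obtain ⟨i, hiσ, hi⟩ := exists_pushMap_one_eq_zero (p := p) hσ hu
    have hiu : u ≠ i := fun h => hu (h ▸ hiσ)
    refine mem_spaceOf.2 ⟨τ.erase i, ⟨(hK τ hτK).2 _ (Finset.erase_subset _ _)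
      ⟨u, Finset.mem_erase.2 ⟨hiu, huτ⟩⟩, ?_⟩, pushMap_nonneg hu zero_le_one le_rfl h0,
      sum_pushMap.trans h1, fun j hj => ?_⟩
    · rintro (h | h)
      · exact Finset.notMem_erase i τ (h ▸ hiσ)
      · exact Finset.notMem_erase i τ
          ((Set.mem_singleton_iff.1 h).symm ▸ hστ.subset hiσ)
    · by_cases hji : j = i
      · rwa [hji]
      · exact hz j fun h => hj (Finset.mem_erase.2 ⟨hji, h⟩)
  have hfix : ∀ p ∈ spaceOf (K \ {σ, τ}), pushMap σ hσ u 1 p = p := by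
    intro p hp
    obtain ⟨υ, hυ, h0, h1, hz⟩ := mem_spaceOf.1 hp
    have hns : ¬ σ ⊆ υ := fun hs => by
      have hυ' : υ ≠ σ ∧ υ ≠ τ := by simpa using hυ.2
      exact hυ'.2 (hfree υ hυ.1 (hs.lt_of_ne hυ'.1.symm))
    obtain ⟨i, hi, hiυ⟩ := Finset.not_subset.1 hns
    exact pushMap_eq_self (le_antisymm (hz i hiυ ▸ Finset.inf'_le (fun i => p i) hi)
      ((Finset.le_inf'_iff _ _).2 fun i _ => h0 i))
  let g : C(spaceOf K, spaceOf (K \ {σ, τ})) :=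
    ⟨fun p => ⟨pushMap σ hσ u 1 p, hmemL p p.2⟩, by
      refine Continuous.subtype_mk ?_ _
      exact (continuous_pushMap hσ).comp (by fun_prop : Continuous fun p : spaceOf K =>
        ((1 : ℝ), (p : EuclideanSpace ℝ (Fin n))))⟩
  let F : ContinuousMap.Homotopy (ContinuousMap.id (spaceOf K))
      ((⟨Set.inclusion hsub, continuous_inclusion hsub⟩ :
        C(spaceOf (K \ {σ, τ}), spaceOf K)).comp g) :=
    { toFun := fun q => ⟨pushMap σ hσ u q.1 q.2, hmemK q.1 q.1.2 q.2 q.2.2⟩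
      continuous_toFun := by
        refine Continuous.subtype_mk ?_ _
        exact (continuous_pushMap hσ).comp (by fun_prop :
          Continuous fun q : unitInterval × spaceOf K =>
            ((q.1 : ℝ), (q.2 : EuclideanSpace ℝ (Fin n))))
      map_zero_left := fun p => Subtype.ext pushMap_zero
      map_one_left := fun p => rfl }
  refine ⟨hsub, ⟨⟨Set.inclusion hsub, continuous_inclusion hsub⟩, g, ?_, ⟨F.symm⟩⟩, rfl⟩
  have : g.comp ⟨Set.inclusion hsub, continuous_inclusion hsub⟩ = ContinuousMap.id _ :=
    ContinuousMap.ext fun p => Subtype.ext (hfix p p.2)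
  rw [this]

lemma CollapsesTo.inclusionHomotopyEquiv {K L : Set (Finset (Fin n))} (hK : IsComplex K)
    (h : CollapsesTo K L) : InclusionHomotopyEquiv K L := by
  induction h using Relation.ReflTransGen.head_induction_on with
  | refl => exact .refl _
  | head h _ ih => exact (h.inclusionHomotopyEquiv hK).trans (ih (h.isComplex hK))

/-- A matching of the simplices of `K \ L` by toggling a vertex `u σ`, along which a monotone
function `f` is constant, yields a collapse, provided that `u` is constant on the level sets of `f`
along inclusions. -/
lemma collapsesTo_of_matching {L : Set (Finset (Fin n))} (f : Finset (Fin n) → ℝ)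
    (u : Finset (Fin n) → Fin n) (K : Set (Finset (Fin n))) (hLK : L ⊆ K)
    (hface : ∀ σ ∈ K, ∀ υ ∈ L, σ ⊆ υ → σ ∈ L)
    (hmono : ∀ σ ∈ K \ L, ∀ υ ∈ K \ L, σ ⊆ υ → f σ ≤ f υ ∧ (f σ = f υ → u σ = u υ))
    (hins : ∀ σ ∈ K \ L, insert (u σ) σ ∈ K \ L ∧ f (insert (u σ) σ) = f σ)
    (hera : ∀ σ ∈ K \ L, σ.erase (u σ) ∈ K \ L ∧ f (σ.erase (u σ)) = f σ) :
    CollapsesTo K L := by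
  induction hN : (K \ L).ncard using Nat.strong_induction_on generalizing K with
  | _ N ih =>
  rcases (K \ L).eq_empty_or_nonempty with hemp | hne
  · rw [hLK.antisymm (Set.sdiff_eq_empty.1 hemp)]
    exact Relation.ReflTransGen.refl
  obtain ⟨τ, hτ, hmax⟩ := Set.exists_max_image (K \ L) (fun σ => toLex (f σ, σ.card))
    (Set.toFinite _) hne
  have hmaxf : ∀ υ ∈ K \ L, f υ ≤ f τ := fun υ hυ => by
    rcases Prod.Lex.toLex_le_toLex.1 (hmax υ hυ) with h | h
    · exact h.le
    · exact h.1.le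
  have hmaxc : ∀ υ ∈ K \ L, f υ = f τ → υ.card ≤ τ.card := fun υ hυ hf => by
    rcases Prod.Lex.toLex_le_toLex.1 (hmax υ hυ) with h | h
    · exact absurd hf h.ne
    · exact h.2
  have humem : ∀ υ ∈ K \ L, f υ = f τ → υ.card = τ.card → u υ ∈ υ := fun υ hυ hf hc => by
    by_contra h
    have := hmaxc _ (hins υ hυ).1 ((hins υ hυ).2.trans hf)
    rw [Finset.card_insert_of_notMem h] at this
    omega
  have huτ := humem τ hτ rfl rfl
  obtain ⟨hσ, hfσ⟩ := hera τ hτ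
  set σ := τ.erase (u τ) with hσdef
  have hστ : σ ⊂ τ := Finset.erase_ssubset huτ
  have hcard : σ.card + 1 = τ.card := Finset.card_erase_add_one huτ
  have huσ : u σ = u τ := (hmono σ hσ τ hτ hστ.subset).2 hfσ
  have hfree : ∀ υ ∈ K, σ ⊂ υ → υ = τ := by
    intro υ hυ hsub
    have hυ' : υ ∈ K \ L := ⟨hυ, fun h => hσ.2 (hface σ hσ.1 υ h hsub.subset)⟩
    have hm := hmono σ hσ υ hυ' hsub.subset
    have hf : f υ = f τ := le_antisymm (hmaxf υ hυ') (hfσ ▸ hm.1)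
    have hlt := Finset.card_lt_card hsub
    have hc : υ.card = τ.card := by have := hmaxc υ hυ' hf; omega
    have hu := humem υ hυ' hf hc
    rw [← hm.2 (hfσ.trans hf.symm), huσ] at hu
    refine (Finset.eq_of_subset_of_card_le ?_ hc.le).symm
    rw [← Finset.insert_erase huτ]
    exact Finset.insert_subset hu hsub.subset
  refine Relation.ReflTransGen.head ⟨σ, τ, hσ.1, hτ.1, hστ, hfree, rfl⟩ ?_
  have hmem : ∀ υ, υ ∈ (K \ {σ, τ}) \ L ↔ υ ∈ K \ L ∧ υ ≠ σ ∧ υ ≠ τ := fun υ => by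
    simp only [Set.mem_sdiff, Set.mem_insert_iff, Set.mem_singleton_iff, not_or]
    tauto
  have hinsσ : insert (u τ) σ = τ := Finset.insert_erase huτ
  refine ih _ ?_ (K \ {σ, τ}) ?_ (fun σ' hσ' => hface σ' hσ'.1) ?_ ?_ ?_ rfl
  · rw [← hN]
    refine Set.ncard_lt_ncard ⟨fun υ hυ => ((hmem υ).1 hυ).1, fun h => ?_⟩ (Set.toFinite _)
    exact ((hmem τ).1 (h hτ)).2.2 rfl
  · intro υ hυ
    refine ⟨hLK hυ, ?_⟩
    rintro (rfl | rfl)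
    · exact hσ.2 hυ
    · exact hτ.2 hυ
  · exact fun υ hυ ω hω => hmono υ ((hmem υ).1 hυ).1 ω ((hmem ω).1 hω).1
  · intro υ hυ
    obtain ⟨hυ, hυσ, hυτ⟩ := (hmem υ).1 hυ
    refine ⟨(hmem _).2 ⟨(hins υ hυ).1, fun h => ?_, fun h => ?_⟩, (hins υ hυ).2⟩
    · have h1 := (hmono υ hυ _ (hins υ hυ).1 (Finset.subset_insert _ _)).2 (hins υ hυ).2.symm
      rw [h, huσ] at h1
      have : u υ ∈ σ := h ▸ Finset.mem_insert_self _ _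
      rw [h1] at this
      exact Finset.notMem_erase _ _ this
    · have h1 := (hmono υ hυ _ (hins υ hυ).1 (Finset.subset_insert _ _)).2 (hins υ hυ).2.symm
      rw [h] at h1
      by_cases hu : u υ ∈ υ
      · rw [Finset.insert_eq_of_mem hu] at h
        exact hυτ h
      · apply hυσ
        rw [hσdef, ← h1, ← h, Finset.erase_insert hu]
  · intro υ hυ
    obtain ⟨hυ, hυσ, hυτ⟩ := (hmem υ).1 hυ
    refine ⟨(hmem _).2 ⟨(hera υ hυ).1, fun h => ?_, fun h => ?_⟩, (hera υ hυ).2⟩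
    · have h1 := (hmono _ (hera υ hυ).1 υ hυ (Finset.erase_subset _ _)).2 (hera υ hυ).2
      rw [h, huσ] at h1
      by_cases hu : u υ ∈ υ
      · apply hυτ
        rw [← hinsσ, ← h, h1, Finset.insert_erase hu]
      · rw [Finset.erase_eq_of_notMem hu] at h
        exact hυσ h
    · have h1 := (hmono _ (hera υ hυ).1 υ hυ (Finset.erase_subset _ _)).2 (hera υ hυ).2
      rw [h] at h1
      rw [h1, ← h] at huτ
      exact Finset.notMem_erase _ _ huτ

/-- **Farkas' lemma** for finitely many linear functionals. -/
lemma exists_nonneg_eq_sum_of_forall_nonpos {ι W : Type*} [DecidableEq ι] [AddCommGroup W]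
    [Module ℝ W] (s : Finset ι) (a : ι → W →ₗ[ℝ] ℝ) (b : W →ₗ[ℝ] ℝ)
    (h : ∀ w, (∀ i ∈ s, a i w ≤ 0) → b w ≤ 0) :
    ∃ l : ι → ℝ, (∀ i, 0 ≤ l i) ∧ b = ∑ i ∈ s, l i • a i := by
  induction s using Finset.induction_on generalizing a b with
  | empty =>
    refine ⟨0, fun _ => le_rfl, LinearMap.ext fun w => ?_⟩
    have h1 := h w (by simp)
    have h2 := h (-w) (by simp)
    rw [map_neg] at h2
    simp only [Finset.sum_empty, LinearMap.zero_apply]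
    linarith
  | insert k s hk ih =>
    have hne : ∀ i ∈ s, i ≠ k := fun i hi hik => hk (hik ▸ hi)
    by_cases hs : ∀ w, (∀ i ∈ s, a i w ≤ 0) → b w ≤ 0
    · obtain ⟨l, hl, hb⟩ := ih a b hs
      refine ⟨Function.update l k 0, fun i => ?_, ?_⟩
      · by_cases hi : i = k <;> simp [hi, hl]
      · rw [Finset.sum_insert hk, hb]
        simp only [Function.update_self, zero_smul, zero_add]
        refine Finset.sum_congr rfl fun i hi => ?_
        rw [Function.update_of_ne (hne i hi)]
    · push Not at hs
      obtain ⟨w₀, hw₀, hbw₀⟩ := hs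
      have hkw₀ : 0 < a k w₀ := by
        by_contra hle
        have := h w₀ fun i hi => by
          rcases Finset.mem_insert.1 hi with rfl | hi
          · exact not_lt.1 hle
          · exact hw₀ i hi
        linarith
      obtain ⟨l, hl, hb⟩ := ih (fun i => a i - (a i w₀ / a k w₀) • a k)
        (b - (b w₀ / a k w₀) • a k) fun w hw => by
          have := h (w - (a k w / a k w₀) • w₀) fun i hi => by
            rcases Finset.mem_insert.1 hi with rfl | hi
            · simp [div_mul_cancel₀ _ hkw₀.ne']
            · have := hw i hi
              simp only [LinearMap.sub_apply, LinearMap.smul_apply, smul_eq_mul, map_sub,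
                map_smul] at this ⊢
              rwa [div_mul_comm]
          simp only [LinearMap.sub_apply, LinearMap.smul_apply, smul_eq_mul, map_sub,
            map_smul] at this ⊢
          rwa [div_mul_comm]
      refine ⟨Function.update l k ((b w₀ - ∑ i ∈ s, l i * a i w₀) / a k w₀), fun i => ?_, ?_⟩
      · by_cases hi : i = k
        · subst hi
          rw [Function.update_self]
          have : ∑ i ∈ s, l i * a i w₀ ≤ 0 :=
            Finset.sum_nonpos fun j hj => mul_nonpos_of_nonneg_of_nonpos (hl j) (hw₀ j hj)
          exact div_nonneg (by linarith) hkw₀.le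
        · rw [Function.update_of_ne hi]
          exact hl i
      · rw [Finset.sum_insert hk, Function.update_self]
        have hupd : ∀ z, ∑ i ∈ s, Function.update l k z i • a i = ∑ i ∈ s, l i • a i := fun z =>
          Finset.sum_congr rfl fun i hi => by rw [Function.update_of_ne (hne i hi)]
        rw [hupd]
        ext w
        have := LinearMap.congr_fun hb w
        simp only [LinearMap.sub_apply, LinearMap.smul_apply, smul_eq_mul, LinearMap.add_apply,
          LinearMap.sum_apply, mul_sub, Finset.sum_sub_distrib] at this ⊢
        have h3 : ∑ i ∈ s, l i * (a i w₀ / a k w₀ * a k w) =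
            (∑ i ∈ s, l i * a i w₀) / a k w₀ * a k w := by
          rw [Finset.sum_div, Finset.sum_mul]
          exact Finset.sum_congr rfl fun i _ => by ring
        rw [h3] at this
        rw [sub_div, sub_mul]
        linarith

/-- The sphere with centre `c` and radius `R` encloses the points of `A` and excludes the points
of `E`. -/
def Separates (x : Fin n → EuclideanSpace ℝ (Fin d)) (A E : Finset (Fin n))
    (c : EuclideanSpace ℝ (Fin d)) (R : ℝ) : Prop :=
  (∀ i ∈ A, dist (x i) c ≤ R) ∧ ∀ i ∈ E, R ≤ dist (x i) c

/-- `c` is the affine combination with weights `w` of points on the sphere with centre `c` and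
radius `R`. -/
structure IsCenterCombo (x : Fin n → EuclideanSpace ℝ (Fin d)) (c : EuclideanSpace ℝ (Fin d))
    (R : ℝ) (w : Fin n → ℝ) : Prop where
  dist_eq : ∀ i, w i ≠ 0 → dist (x i) c = R
  sum_eq_one : ∑ i, w i = 1
  sum_smul_eq : ∑ i, w i • x i = c

/-- A sphere that separates `A` from `E`, together with Karush–Kuhn–Tucker multipliers showing that
it is the smallest such sphere. -/
def IsMinSphere (x : Fin n → EuclideanSpace ℝ (Fin d)) (A E : Finset (Fin n))
    (c : EuclideanSpace ℝ (Fin d)) (R : ℝ) : Prop :=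
  Separates x A E c R ∧ ∃ w, IsCenterCombo x c R w ∧ (∀ i, 0 < w i → i ∈ A) ∧
    ∀ i, w i < 0 → i ∈ E

section Spheres

variable {x : Fin n → EuclideanSpace ℝ (Fin d)} {A A' E E' : Finset (Fin n)}
  {c c' : EuclideanSpace ℝ (Fin d)} {R R' : ℝ} {w w' : Fin n → ℝ}

lemma Separates.mono (h : Separates x A' E' c R) (hA : A ⊆ A') (hE : E ⊆ E') :
    Separates x A E c R :=
  ⟨fun i hi => h.1 i (hA hi), fun i hi => h.2 i (hE hi)⟩

lemma Separates.nonneg (h : Separates x A E c R) (hA : A.Nonempty) : 0 ≤ R :=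
  hA.elim fun i hi => dist_nonneg.trans (h.1 i hi)

lemma IsCenterCombo.sum_mul_power (hw : IsCenterCombo x c R w)
    (c' : EuclideanSpace ℝ (Fin d)) (R' : ℝ) :
    ∑ i, w i * (dist (x i) c' ^ 2 - R' ^ 2) = R ^ 2 + dist c c' ^ 2 - R' ^ 2 := by
  have hterm : ∀ i, w i * (dist (x i) c' ^ 2 - R' ^ 2) =
      w i * (R ^ 2 + dist c c' ^ 2 - R' ^ 2) + 2 * inner ℝ (w i • (x i - c)) (c - c') := by
    intro i
    by_cases hi : w i = 0
    · simp [hi]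
    · have h1 : x i - c' = (x i - c) + (c - c') := by abel
      rw [← hw.dist_eq i hi, dist_eq_norm, dist_eq_norm, dist_eq_norm, h1, norm_add_sq_real,
        real_inner_smul_left]
      ring
  have hzero : ∑ i, w i • (x i - c) = 0 := by
    simp only [smul_sub, Finset.sum_sub_distrib, hw.sum_smul_eq, ← Finset.sum_smul,
      hw.sum_eq_one, one_smul, sub_self]
  rw [Finset.sum_congr rfl fun i _ => hterm i, Finset.sum_add_distrib, ← Finset.sum_mul,
    hw.sum_eq_one, ← Finset.mul_sum, ← sum_inner, hzero, inner_zero_left]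
  ring

lemma IsMinSphere.sq_add_le (h : IsMinSphere x A E c R) (hA : A.Nonempty)
    (h' : Separates x A E c' R') : R ^ 2 + dist c c' ^ 2 ≤ R' ^ 2 := by
  obtain ⟨-, w, hw, hpos, hneg⟩ := h
  have hR' := h'.nonneg hA
  have hle : ∑ i, w i * (dist (x i) c' ^ 2 - R' ^ 2) ≤ 0 := by
    refine Finset.sum_nonpos fun i _ => ?_
    rcases lt_trichotomy (w i) 0 with hi | hi | hi
    · have := pow_le_pow_left₀ hR' (h'.2 i (hneg i hi)) 2
      exact mul_nonpos_of_nonpos_of_nonneg hi.le (by linarith)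
    · simp [hi]
    · have := pow_le_pow_left₀ dist_nonneg (h'.1 i (hpos i hi)) 2
      exact mul_nonpos_of_nonneg_of_nonpos hi.le (by linarith)
  rw [hw.sum_mul_power] at hle
  linarith

lemma IsMinSphere.le (h : IsMinSphere x A E c R) (hA : A.Nonempty)
    (h' : Separates x A E c' R') : R ≤ R' := by
  have := h.sq_add_le hA h'
  exact le_of_sq_le_sq (by nlinarith [sq_nonneg (dist c c')]) (h'.nonneg hA)

lemma IsMinSphere.center_eq (h : IsMinSphere x A E c R) (hA : A.Nonempty)
    (h' : Separates x A E c' R) : c = c' := by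
  have := h.sq_add_le hA h'
  have h0 : dist c c' ^ 2 = 0 := le_antisymm (by linarith) (sq_nonneg _)
  exact dist_eq_zero.1 (pow_eq_zero_iff two_ne_zero |>.1 h0)

lemma IsMinSphere.sInf_eq (h : IsMinSphere x A E c R) (hA : A.Nonempty) :
    sInf {R | ∃ c, Separates x A E c R} = R :=
  IsLeast.csInf_eq ⟨⟨c, h.1⟩, fun _ ⟨_, h'⟩ => h.le hA h'⟩

lemma Separates.exists_minimal (h : Separates x A E c R) (hA : A.Nonempty) :
    ∃ c₀ R₀, Separates x A E c₀ R₀ ∧ ∀ c' R', Separates x A E c' R' → R₀ ≤ R' := by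
  obtain ⟨a, ha⟩ := hA
  have hclosed : IsClosed {q : EuclideanSpace ℝ (Fin d) × ℝ | Separates x A E q.1 q.2} := by
    simp only [Separates, Set.ofPred_and, Set.ofPred_forall]
    refine (isClosed_biInter fun i _ => ?_).inter (isClosed_biInter fun i _ => ?_)
    · exact isClosed_le (by fun_prop) (by fun_prop)
    · exact isClosed_le (by fun_prop) (by fun_prop)
  have hcomp := ((isCompact_closedBall (x a) R).prod (isCompact_Icc (a := 0) (b := R))).inter_right
    hclosed
  have hmem : ∀ c' R', Separates x A E c' R' → R' ≤ R →
      (c', R') ∈ (Metric.closedBall (x a) R ×ˢ Set.Icc 0 R) ∩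
        {q : EuclideanSpace ℝ (Fin d) × ℝ | Separates x A E q.1 q.2} := fun c' R' h' hle =>
    ⟨⟨Metric.mem_closedBall'.2 ((h'.1 a ha).trans hle), h'.nonneg ⟨a, ha⟩, hle⟩, h'⟩
  obtain ⟨q, hq, hmin⟩ := hcomp.exists_isMinOn ⟨_, hmem c R h le_rfl⟩ continuous_snd.continuousOn
  refine ⟨q.1, q.2, hq.2, fun c' R' h' => ?_⟩
  rcases le_total R' R with hle | hle
  · exact hmin (hmem c' R' h' hle)
  · exact hq.1.2.2.trans hle

open Filter Topology in
/-- Moving the centre in direction `v` and changing the squared radius at rate `2 * t < 0` shows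
that a sphere is not minimal. -/
lemma Separates.nonneg_of_minimal (h : Separates x A E c R) (hA : A.Nonempty)
    (hmin : ∀ c' R', Separates x A E c' R' → R ≤ R') {v : EuclideanSpace ℝ (Fin d)} {t : ℝ}
    (hvA : ∀ i ∈ A, dist (x i) c = R → 0 ≤ inner ℝ (x i - c) v + t)
    (hvE : ∀ i ∈ E, dist (x i) c = R → inner ℝ (x i - c) v + t ≤ 0) : 0 ≤ t := by
  by_contra! ht
  have hR : 0 < R := by
    refine (h.nonneg hA).lt_of_ne fun h0 => ?_
    obtain ⟨a, ha⟩ := hA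
    have hd : dist (x a) c = 0 := le_antisymm (h0 ▸ h.1 a ha) dist_nonneg
    have := hvA a ha (hd.trans h0)
    rw [dist_eq_zero.1 hd, sub_self, inner_zero_left] at this
    linarith
  let q : ℝ → ℝ := fun ε => R ^ 2 + 2 * ε * t + ε ^ 2 * ‖v‖ ^ 2
  have hq : Continuous q := by fun_prop
  have hq0 : q 0 = R ^ 2 := by simp [q]
  have hdist : ∀ i ε, dist (x i) (c + ε • v) ^ 2 =
      dist (x i) c ^ 2 - 2 * ε * inner ℝ (x i - c) v + ε ^ 2 * ‖v‖ ^ 2 := fun i ε => by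
    rw [dist_eq_norm, dist_eq_norm, ← sub_sub, norm_sub_sq_real, norm_smul, mul_pow,
      real_inner_smul_right, Real.norm_eq_abs, sq_abs]
    ring
  have hcont : ∀ i, Continuous fun ε : ℝ => dist (x i) (c + ε • v) ^ 2 := fun i => by fun_prop
  have hε : ∀ᶠ ε in 𝓝[>] (0 : ℝ), 0 < ε := self_mem_nhdsWithin
  have hA' : ∀ᶠ ε in 𝓝[>] (0 : ℝ), ∀ i ∈ A, dist (x i) (c + ε • v) ^ 2 ≤ q ε := by
    rw [Filter.eventually_all_finset]
    intro i hi
    by_cases hon : dist (x i) c = R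
    · filter_upwards [hε] with ε hε
      have := mul_nonneg hε.le (hvA i hi hon)
      rw [hdist, hon]
      simp only [q]
      linarith
    · have hlt : dist (x i) c < R := (h.1 i hi).lt_of_ne hon
      have : ∀ᶠ ε in 𝓝 (0 : ℝ), dist (x i) (c + ε • v) ^ 2 < q ε :=
        (hcont i).continuousAt.eventually_lt hq.continuousAt (by
          simpa [hq0] using pow_lt_pow_left₀ hlt dist_nonneg two_ne_zero)
      exact (this.filter_mono nhdsWithin_le_nhds).mono fun _ h => h.le
  have hE' : ∀ᶠ ε in 𝓝[>] (0 : ℝ), ∀ i ∈ E, q ε ≤ dist (x i) (c + ε • v) ^ 2 := by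
    rw [Filter.eventually_all_finset]
    intro i hi
    by_cases hon : dist (x i) c = R
    · filter_upwards [hε] with ε hε
      have := mul_nonpos_of_nonneg_of_nonpos hε.le (hvE i hi hon)
      rw [hdist, hon]
      simp only [q]
      linarith
    · have hlt : R < dist (x i) c := (h.2 i hi).lt_of_ne (Ne.symm hon)
      have : ∀ᶠ ε in 𝓝 (0 : ℝ), q ε < dist (x i) (c + ε • v) ^ 2 :=
        hq.continuousAt.eventually_lt (hcont i).continuousAt (by
          simpa [hq0] using pow_lt_pow_left₀ hlt hR.le two_ne_zero)
      exact (this.filter_mono nhdsWithin_le_nhds).mono fun _ h => h.le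
  have hqpos : ∀ᶠ ε in 𝓝[>] (0 : ℝ), 0 < q ε :=
    (continuousAt_const.eventually_lt hq.continuousAt (by
      rw [hq0]; positivity)).filter_mono nhdsWithin_le_nhds
  have hqlt : ∀ᶠ ε in 𝓝[>] (0 : ℝ), q ε < R ^ 2 := by
    have : ∀ᶠ ε in 𝓝 (0 : ℝ), 2 * t + ε * ‖v‖ ^ 2 < 0 :=
      ContinuousAt.eventually_lt (by fun_prop) continuousAt_const (by simpa using by linarith)
    filter_upwards [hε, this.filter_mono nhdsWithin_le_nhds] with ε hε h
    have := mul_neg_of_pos_of_neg hε h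
    simp only [q]
    linarith
  obtain ⟨ε, hεA, hεE, hpos, hlt⟩ := (hA'.and (hE'.and (hqpos.and hqlt))).exists
  have := hmin (c + ε • v) (√(q ε))
    ⟨fun i hi => Real.le_sqrt_of_sq_le (hεA i hi),
      fun i hi => Real.sqrt_le_iff.2 ⟨dist_nonneg, hεE i hi⟩⟩
  exact absurd ((Real.sqrt_lt' hR).2 hlt) (not_lt.2 this)

lemma Separates.isMinSphere_of_minimal (h : Separates x A E c R) (hA : A.Nonempty)
    (hmin : ∀ c' R', Separates x A E c' R' → R ≤ R') : IsMinSphere x A E c R := by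
  classical
  let φ : Fin n → (EuclideanSpace ℝ (Fin d) × ℝ) →ₗ[ℝ] ℝ := fun i =>
    (innerₛₗ ℝ (x i - c)).comp (LinearMap.fst ℝ _ _) + LinearMap.snd ℝ _ _
  have hφ : ∀ i q, φ i q = inner ℝ (x i - c) q.1 + q.2 := fun i q => rfl
  let Aon := A.filter fun i => dist (x i) c = R
  let Eon := E.filter fun i => dist (x i) c = R
  obtain ⟨l, hl, hb⟩ := exists_nonneg_eq_sum_of_forall_nonpos (Aon.disjSum Eon)
    (Sum.elim (fun i => -φ i) φ) (-LinearMap.snd ℝ (EuclideanSpace ℝ (Fin d)) ℝ) fun q hq => by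
      simp only [LinearMap.neg_apply, LinearMap.snd_apply, Left.neg_nonpos_iff]
      refine h.nonneg_of_minimal hA hmin (v := q.1) (fun i hi hon => ?_) fun i hi hon => ?_
      · have := hq (Sum.inl i) (Finset.inl_mem_disjSum.2 (Finset.mem_filter.2 ⟨hi, hon⟩))
        simp only [Sum.elim_inl, LinearMap.neg_apply, Left.neg_nonpos_iff, hφ] at this
        exact this
      · exact hq (Sum.inr i) (Finset.inr_mem_disjSum.2 (Finset.mem_filter.2 ⟨hi, hon⟩))
  let w : Fin n → ℝ := fun i =>
    (if i ∈ Aon then l (Sum.inl i) else 0) - if i ∈ Eon then l (Sum.inr i) else 0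
  have hsum : ∀ q, ∑ i, w i * φ i q = q.2 := fun q => by
    have := LinearMap.congr_fun hb q
    simp only [Finset.sum_disjSum, LinearMap.add_apply, LinearMap.neg_apply,
      LinearMap.snd_apply, LinearMap.sum_apply, LinearMap.smul_apply, Sum.elim_inl,
      Sum.elim_inr, smul_eq_mul, mul_neg, Finset.sum_neg_distrib] at this
    simp only [w, sub_mul, ite_mul, zero_mul, Finset.sum_sub_distrib, Finset.sum_ite_mem,
      Finset.univ_inter]
    linarith
  have hpos : ∀ i, 0 < w i → i ∈ Aon := fun i hi => by
    by_contra hA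
    have := hl (Sum.inr i)
    simp only [w, hA, if_false] at hi
    split_ifs at hi <;> linarith
  have hneg : ∀ i, w i < 0 → i ∈ Eon := fun i hi => by
    by_contra hE
    have := hl (Sum.inl i)
    simp only [w, hE, if_false] at hi
    split_ifs at hi <;> linarith
  have hone : ∑ i, w i = 1 := by simpa [hφ] using hsum (0, 1)
  refine ⟨h, w, ⟨fun i hi => ?_, hone, ?_⟩, fun i hi => (Finset.mem_filter.1 (hpos i hi)).1,
    fun i hi => (Finset.mem_filter.1 (hneg i hi)).1⟩
  · rcases hi.lt_or_gt with hi | hi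
    · exact (Finset.mem_filter.1 (hneg i hi)).2
    · exact (Finset.mem_filter.1 (hpos i hi)).2
  · have hz : ∑ i, w i • (x i - c) = 0 := ext_inner_right ℝ fun v => by
      simpa [hφ, sum_inner, real_inner_smul_left] using hsum (v, 0)
    simp only [smul_sub, Finset.sum_sub_distrib, ← Finset.sum_smul, hone, one_smul] at hz
    exact sub_eq_zero.1 hz

lemma Separates.exists_isMinSphere (h : Separates x A E c R) (hA : A.Nonempty) :
    ∃ c₀ R₀, IsMinSphere x A E c₀ R₀ := by
  obtain ⟨c₀, R₀, h₀, hmin⟩ := h.exists_minimal hA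
  exact ⟨c₀, R₀, h₀.isMinSphere_of_minimal hA hmin⟩

/-- Discard points from an affine combination until at most `d + 1` remain. -/
lemma IsCenterCombo.exists_card_le (hinj : Function.Injective x) (hw : IsCenterCombo x c R w) :
    ∃ w', IsCenterCombo x c R w' ∧ (Finset.univ.filter fun i => w' i ≠ 0).card ≤ d + 1 := by
  classical
  induction hN : (Finset.univ.filter fun i => w i ≠ 0).card using Nat.strong_induction_on
    generalizing w with
  | _ N ih =>
  by_cases hle : N ≤ d + 1
  · exact ⟨w, hw, hN ▸ hle⟩
  set s := Finset.univ.filter fun i => w i ≠ 0 with hs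
  have hmem : ∀ i, i ∈ s ↔ w i ≠ 0 := by simp [hs]
  obtain ⟨f, hf, hf0, p, hp, hfp⟩ :=
    Module.exists_nontrivial_relation_sum_zero_of_finrank_succ_lt_card (R := ℝ)
      (t := s.image x) (by
        rw [Finset.card_image_of_injective _ hinj, finrank_euclideanSpace_fin]
        omega)
  rw [Finset.sum_image hinj.injOn] at hf hf0
  obtain ⟨j, hj, rfl⟩ := Finset.mem_image.1 hp
  let b : Fin n → ℝ := fun i => if i ∈ s then f (x i) else 0
  have hb : ∑ i, b i = 0 := by simpa [b] using hf0
  have hbx : ∑ i, b i • x i = 0 := by simpa [b, ite_smul] using hf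
  have hbj : b j ≠ 0 := by simpa [b, hj] using hfp
  let w' : Fin n → ℝ := fun i => w i - w j / b j * b i
  have hw'0 : ∀ i, w i = 0 → w' i = 0 := fun i hi => by
    have : i ∉ s := fun h => (hmem i).1 h hi
    simp [w', b, this, hi]
  have hw' : IsCenterCombo x c R w' := by
    refine ⟨fun i hi => hw.dist_eq i fun h => hi (hw'0 i h), ?_, ?_⟩
    · simp only [w', Finset.sum_sub_distrib, ← Finset.mul_sum, hb, hw.sum_eq_one]
      simp
    · simp only [w', sub_smul, mul_smul, Finset.sum_sub_distrib, ← Finset.smul_sum, hbx,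
        hw.sum_smul_eq]
      simp
  refine ih _ ?_ hw' rfl
  rw [← hN]
  refine Finset.card_lt_card (Finset.ssubset_iff_of_subset (fun i hi => ?_) |>.2 ⟨j, hj, ?_⟩)
  · rw [Finset.mem_filter] at hi
    exact (hmem i).2 fun h => hi.2 (hw'0 i h)
  · simp [w', div_mul_cancel₀ _ hbj]

lemma IsCenterCombo.unique (hinj : Function.Injective x) (hgp : GenPos x)
    (hw : IsCenterCombo x c R w) (hw' : IsCenterCombo x c R w') : w = w' := by
  obtain ⟨w₀, hw₀, hcard⟩ := hw.exists_card_le hinj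
  set s := Finset.univ.filter fun i => w₀ i ≠ 0 with hs
  have hmem : ∀ i, i ∈ s ↔ w₀ i ≠ 0 := by simp [hs]
  have hne : s.Nonempty := by
    obtain ⟨i, -, hi⟩ := Finset.exists_ne_zero_of_sum_ne_zero
      (hw₀.sum_eq_one.trans_ne one_ne_zero)
    exact ⟨i, (hmem i).2 hi⟩
  obtain ⟨hind, hsphere⟩ := hgp s hne hcard
  have hon : ∀ j, dist (x j) c = R → j ∈ s := by
    intro j hj
    by_contra hjs
    refine hsphere c R ⟨fun i hi => hw₀.dist_eq i ((hmem i).1 hi), fun c' r' h' => ?_⟩ j hjs hj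
    have hr' : 0 ≤ r' := hne.elim fun i hi => h' i hi ▸ dist_nonneg
    have h0 : ∑ i, w₀ i * (dist (x i) c' ^ 2 - r' ^ 2) = 0 :=
      Finset.sum_eq_zero fun i _ => by
        by_cases hi : w₀ i = 0
        · simp [hi]
        · simp [h' i ((hmem i).2 hi)]
    rw [hw₀.sum_mul_power] at h0
    exact le_of_sq_le_sq (by nlinarith [sq_nonneg (dist c c')]) hr'
  have hzero : ∀ i ∉ s, w i - w' i = 0 := fun i hi => by
    have h1 : w i = 0 := by
      by_contra h
      exact hi (hon i (hw.dist_eq i h))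
    have h2 : w' i = 0 := by
      by_contra h
      exact hi (hon i (hw'.dist_eq i h))
    rw [h1, h2, sub_zero]
  have hsum1 : ∑ i : s, (w i - w' i) = 0 := by
    rw [Finset.sum_coe_sort s fun i => w i - w' i,
      Finset.sum_subset (Finset.subset_univ s) fun i _ hi => hzero i hi,
      Finset.sum_sub_distrib, hw.sum_eq_one, hw'.sum_eq_one, sub_self]
  have hsum2 : ∑ i : s, (w i - w' i) • x i = 0 := by
    rw [Finset.sum_coe_sort s fun i => (w i - w' i) • x i,
      Finset.sum_subset (Finset.subset_univ s) fun i _ hi => by rw [hzero i hi, zero_smul]]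
    simp only [sub_smul, Finset.sum_sub_distrib, hw.sum_smul_eq, hw'.sum_smul_eq, sub_self]
  funext i
  by_cases hi : i ∈ s
  · exact sub_eq_zero.1 (affineIndependent_iff.1 hind Finset.univ (fun i => w i - w' i) hsum1 hsum2
      ⟨i, hi⟩ (Finset.mem_univ _))
  · exact sub_eq_zero.1 (hzero i hi)

lemma IsMinSphere.exists_neg_and_dist_lt (h : IsMinSphere x A E c R) (hA : A.Nonempty)
    (h' : Separates x A ∅ c' R') (hlt : R' < R) :
    ∃ u w, IsCenterCombo x c R w ∧ w u < 0 ∧ dist (x u) c' < R' := by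
  obtain ⟨-, w, hw, hpos, -⟩ := h
  have hR' := h'.nonneg hA
  by_contra! hcon
  have hle : ∑ i, w i * (dist (x i) c' ^ 2 - R' ^ 2) ≤ 0 := by
    refine Finset.sum_nonpos fun i _ => ?_
    rcases lt_trichotomy (w i) 0 with hi | hi | hi
    · have := pow_le_pow_left₀ hR' (hcon i w hw hi) 2
      exact mul_nonpos_of_nonpos_of_nonneg hi.le (by linarith)
    · simp [hi]
    · have := pow_le_pow_left₀ dist_nonneg (h'.1 i (hpos i hi)) 2
      exact mul_nonpos_of_nonneg_of_nonpos hi.le (by linarith)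
  rw [hw.sum_mul_power] at hle
  nlinarith [sq_nonneg (dist c c')]

lemma IsMinSphere.congr_of_nonpos (h : Separates x A' E c R) {u : Fin n}
    (hA : ∀ i ∈ A, i ≠ u → i ∈ A') (hw : IsCenterCombo x c R w) (hu : w u ≤ 0)
    (hpos : ∀ i, 0 < w i → i ∈ A) (hneg : ∀ i, w i < 0 → i ∈ E) : IsMinSphere x A' E c R :=
  ⟨h, w, hw, fun i hi => hA i (hpos i hi) fun hiu => (hiu ▸ hi).not_ge hu, hneg⟩

lemma IsMinSphere.insert_erase (hinj : Function.Injective x) (hgp : GenPos x)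
    (h : IsMinSphere x A E c R) (hw : IsCenterCombo x c R w) {u : Fin n} (hu : w u ≤ 0)
    (hdist : dist (x u) c ≤ R) :
    IsMinSphere x (insert u A) E c R ∧ IsMinSphere x (A.erase u) E c R := by
  obtain ⟨hsep, w₀, hw₀, hpos, hneg⟩ := h
  obtain rfl := hw₀.unique hinj hgp hw
  refine ⟨.congr_of_nonpos ⟨fun i hi => ?_, hsep.2⟩
    (fun i hi _ => Finset.mem_insert_of_mem hi) hw hu hpos hneg,
    .congr_of_nonpos (hsep.mono (Finset.erase_subset _ _) subset_rfl)
      (fun i hi hiu => Finset.mem_erase.2 ⟨hiu, hi⟩) hw hu hpos hneg⟩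
  rcases Finset.mem_insert.1 hi with rfl | hi
  · exact hdist
  · exact hsep.1 i hi

lemma IsMinSphere.insert_erase_of_dist_lt (hinj : Function.Injective x) (hgp : GenPos x)
    (h : IsMinSphere x A E c R) {u : Fin n} (hdist : dist (x u) c < R) :
    IsMinSphere x (insert u A) E c R ∧ IsMinSphere x (A.erase u) E c R := by
  obtain ⟨-, w, hw, -⟩ := id h
  refine h.insert_erase hinj hgp hw (le_of_eq ?_) hdist.le
  by_contra hu
  exact hdist.ne (hw.dist_eq u hu)

end Spheres

/-- The vertices preceding the last vertex of `σ`. -/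
def below (σ : Finset (Fin n)) : Finset (Fin n) :=
  Finset.univ.filter fun i => ∃ j ∈ σ, i < j

lemma mem_below {σ : Finset (Fin n)} {i : Fin n} : i ∈ below σ ↔ ∃ j ∈ σ, i < j := by
  simp [below]

lemma below_mono {σ υ : Finset (Fin n)} (h : σ ⊆ υ) : below σ ⊆ below υ := fun i hi => by
  obtain ⟨j, hj, hij⟩ := mem_below.1 hi
  exact mem_below.2 ⟨j, h hj, hij⟩

lemma below_insert {σ : Finset (Fin n)} {u : Fin n} (hu : u ∈ below σ) :
    below (insert u σ) = below σ := by
  refine Finset.Subset.antisymm (fun i hi => ?_) (below_mono (Finset.subset_insert _ _))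
  obtain ⟨j, hj, hij⟩ := mem_below.1 hi
  rcases Finset.mem_insert.1 hj with rfl | hj
  · obtain ⟨k, hk, hjk⟩ := mem_below.1 hu
    exact mem_below.2 ⟨k, hk, hij.trans hjk⟩
  · exact mem_below.2 ⟨j, hj, hij⟩

lemma below_erase {σ : Finset (Fin n)} {u : Fin n} (hu : u ∈ below σ) :
    below (σ.erase u) = below σ := by
  refine (below_mono (Finset.erase_subset _ _)).antisymm fun i hi => ?_
  obtain ⟨j, hj, hij⟩ := mem_below.1 hi
  obtain ⟨k, hk, huk⟩ := mem_below.1 hu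
  by_cases hju : j = u
  · exact mem_below.2 ⟨k, Finset.mem_erase.2 ⟨huk.ne', hk⟩, hij.trans (hju ▸ huk)⟩
  · exact mem_below.2 ⟨j, Finset.mem_erase.2 ⟨hju, hj⟩, hij⟩

lemma erase_nonempty_of_mem_below {σ : Finset (Fin n)} {u : Fin n} (hu : u ∈ below σ) :
    (σ.erase u).Nonempty := by
  obtain ⟨k, hk, huk⟩ := mem_below.1 hu
  exact ⟨k, Finset.mem_erase.2 ⟨huk.ne', hk⟩⟩

section Radii

variable {x : Fin n → EuclideanSpace ℝ (Fin d)} {γ : Fin n → ℝ} {r s : ℝ}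
  {σ υ : Finset (Fin n)}

lemma incrSet_eq (hσ : σ.Nonempty) : incrSet x σ = {R | ∃ c, Separates x σ (below σ) c R} := by
  ext R
  have hbelow : ∀ i, i ∈ below σ ↔ i < σ.max' hσ := fun i => mem_below.trans
    ⟨fun ⟨j, hj, hij⟩ => hij.trans_le (σ.le_max' j hj), fun h => ⟨_, σ.max'_mem hσ, h⟩⟩
  constructor
  · rintro ⟨_, c, h1, h2, h3⟩
    refine ⟨c, fun i hi => ?_, fun i hi => h3 i ((hbelow i).1 hi)⟩
    by_cases him : i = σ.max' hσ
    · exact him ▸ h2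
    · exact (h1 i (Finset.mem_erase.2 ⟨him, hi⟩)).le
  · rintro ⟨c, h1, h2⟩
    refine ⟨hσ, c, fun i hi => ?_, h1 _ (σ.max'_mem hσ), fun i hi => h2 i ((hbelow i).2 hi)⟩
    obtain ⟨him, hi⟩ := Finset.mem_erase.1 hi
    exact (h1 i hi).antisymm (h2 i ((hbelow i).2 ((σ.le_max' i hi).lt_of_ne him)))

lemma mebSet_eq : mebSet x σ = {R | ∃ c, Separates x σ ∅ c R} := by
  simp [mebSet, Separates]

lemma exists_max'_le_iff (hγ : Monotone γ) :
    (∃ h : σ.Nonempty, γ (σ.max' h) ≤ s) ↔ σ.Nonempty ∧ ∀ i ∈ σ, γ i ≤ s :=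
  ⟨fun ⟨h, hs⟩ => ⟨h, fun i hi => (hγ (σ.le_max' i hi)).trans hs⟩,
    fun ⟨h, hs⟩ => ⟨h, hs _ (σ.max'_mem h)⟩⟩

lemma incrSet_nonempty_of_subset (hσ : σ.Nonempty) (h : σ ⊆ υ) (hυ : (incrSet x υ).Nonempty) :
    (incrSet x σ).Nonempty := by
  rw [incrSet_eq hσ]
  rw [incrSet_eq (hσ.mono h)] at hυ
  obtain ⟨R, c, hc⟩ := hυ
  exact ⟨R, c, hc.mono h (below_mono h)⟩

lemma sInf_incrSet_le_of_subset (hσ : σ.Nonempty) (h : σ ⊆ υ) (hυ : (incrSet x υ).Nonempty) :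
    sInf (incrSet x σ) ≤ sInf (incrSet x υ) := by
  rw [incrSet_eq hσ]
  rw [incrSet_eq (hσ.mono h)] at hυ ⊢
  exact csInf_le_csInf ⟨0, fun R ⟨c, hc⟩ => hc.nonneg hσ⟩ hυ
    fun R ⟨c, hc⟩ => ⟨c, hc.mono h (below_mono h)⟩

lemma sInf_mebSet_le_of_subset (hσ : σ.Nonempty) (h : σ ⊆ υ) (hυ : (incrSet x υ).Nonempty) :
    sInf (mebSet x σ) ≤ sInf (mebSet x υ) := by
  rw [incrSet_eq (hσ.mono h)] at hυ
  obtain ⟨R, c, hc⟩ := hυ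
  rw [mebSet_eq, mebSet_eq]
  exact csInf_le_csInf ⟨0, fun R ⟨c, hc⟩ => hc.nonneg hσ⟩
    ⟨R, c, hc.mono subset_rfl (Finset.empty_subset _)⟩
    fun R ⟨c, hc⟩ => ⟨c, hc.mono h subset_rfl⟩

lemma sInf_mebSet_le_sInf_incrSet (hσ : σ.Nonempty) (h : (incrSet x σ).Nonempty) :
    sInf (mebSet x σ) ≤ sInf (incrSet x σ) := by
  rw [incrSet_eq hσ] at h ⊢
  rw [mebSet_eq]
  exact csInf_le_csInf ⟨0, fun R ⟨c, hc⟩ => hc.nonneg hσ⟩ h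
    fun R ⟨c, hc⟩ => ⟨c, hc.mono subset_rfl (Finset.empty_subset _)⟩

lemma DelBiMem.delCechBiMem (h : DelBiMem x γ r s σ) : DelCechBiMem x γ r s σ :=
  ⟨h.1, (sInf_mebSet_le_sInf_incrSet h.2.2.1 h.1).trans h.2.1, h.2.2⟩

lemma DelBiMem.of_subset (hγ : Monotone γ) (h : DelBiMem x γ r s υ) (hσ : σ.Nonempty)
    (hsub : σ ⊆ υ) : DelBiMem x γ r s σ :=
  ⟨incrSet_nonempty_of_subset hσ hsub h.1,
    (sInf_incrSet_le_of_subset hσ hsub h.1).trans h.2.1,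
    (exists_max'_le_iff hγ).2 ⟨hσ, fun i hi => ((exists_max'_le_iff hγ).1 h.2.2).2 i (hsub hi)⟩⟩

lemma isComplex_delCech (hγ : Monotone γ) : IsComplex {σ | DelCechBiMem x γ r s σ} :=
  fun _ h => ⟨h.2.2.1, fun _ hsub hσ => ⟨incrSet_nonempty_of_subset hσ hsub h.1,
    (sInf_mebSet_le_of_subset hσ hsub h.1).trans h.2.1,
    (exists_max'_le_iff hγ).2
      ⟨hσ, fun i hi => ((exists_max'_le_iff hγ).1 h.2.2).2 i (hsub hi)⟩⟩⟩

lemma mem_delCech_diff_del_iff (hγ : Monotone γ) {c c₀ : EuclideanSpace ℝ (Fin d)} {R R₀ : ℝ}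
    (hσ : σ.Nonempty) (h : IsMinSphere x σ (below σ) c R) (h₀ : IsMinSphere x σ ∅ c₀ R₀) :
    σ ∈ {σ | DelCechBiMem x γ r s σ} \ {σ | DelBiMem x γ r s σ} ↔
      R₀ ≤ r ∧ r < R ∧ ∀ i ∈ σ, γ i ≤ s := by
  have hne : (incrSet x σ).Nonempty := incrSet_eq (x := x) hσ ▸ ⟨R, c, h.1⟩
  simp only [Set.mem_sdiff, Set.mem_ofPred_eq, DelCechBiMem, DelBiMem, exists_max'_le_iff hγ,
    mebSet_eq, h₀.sInf_eq hσ, true_and, incrSet_eq hσ, h.sInf_eq hσ, hσ, not_and]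
  rw [← incrSet_eq hσ]
  simp only [hne, true_and, forall_const]
  constructor
  · rintro ⟨⟨h1, h2⟩, h3⟩
    exact ⟨h1, lt_of_not_ge fun h => h3 h h2, h2⟩
  · rintro ⟨h1, h2, h3⟩
    exact ⟨⟨h1, h3⟩, fun h => absurd h h2.not_ge⟩

end Radii

theorem collapsesTo_delCech_del {x : Fin n → EuclideanSpace ℝ (Fin d)}
    (hinj : Function.Injective x) (hgp : GenPos x) {γ : Fin n → ℝ} (hγ : Monotone γ) (r s : ℝ) :
    CollapsesTo {σ | DelCechBiMem x γ r s σ} {σ | DelBiMem x γ r s σ} := by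
  set K := {σ | DelCechBiMem x γ r s σ}
  set L := {σ | DelBiMem x γ r s σ}
  have hLK : L ⊆ K := fun σ h => DelBiMem.delCechBiMem h
  rcases (K \ L).eq_empty_or_nonempty with hemp | ⟨σ₀, hσ₀⟩
  · rw [hLK.antisymm (Set.sdiff_eq_empty.1 hemp)]
    exact Relation.ReflTransGen.refl
  have : Nonempty (Fin n) := hσ₀.1.2.2.1.elim fun i _ => ⟨i⟩
  have hKne : ∀ σ ∈ K, σ.Nonempty := fun σ hσ => hσ.2.2.1
  have hsph : ∀ σ ∈ K, ∃ c R c₀ R₀, IsMinSphere x σ (below σ) c R ∧ IsMinSphere x σ ∅ c₀ R₀ := by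
    intro σ hσ
    have h := hσ.1
    rw [incrSet_eq (hKne σ hσ)] at h
    obtain ⟨R, c, hc⟩ := h
    obtain ⟨c₁, R₁, h₁⟩ := hc.exists_isMinSphere (hKne σ hσ)
    obtain ⟨c₂, R₂, h₂⟩ :=
      (hc.mono subset_rfl (Finset.empty_subset _)).exists_isMinSphere (hKne σ hσ)
    exact ⟨c₁, R₁, c₂, R₂, h₁, h₂⟩
  choose! c R c₀ R₀ hS hS₀ using hsph
  let u : Finset (Fin n) → Fin n := fun σ => Classical.epsilon fun u =>
    ∃ w, IsCenterCombo x (c σ) (R σ) w ∧ w u < 0 ∧ dist (x u) (c₀ σ) < R₀ σ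
  have huniq : ∀ σ ∈ K, ∀ {c' R'}, IsMinSphere x σ (below σ) c' R' → R σ = R' := by
    intro σ hσ c' R' h
    exact ((hS σ hσ).le (hKne σ hσ) h.1).antisymm (h.le (hKne σ hσ) (hS σ hσ).1)
  have huniq₀ : ∀ σ ∈ K, ∀ {c' R'}, IsMinSphere x σ ∅ c' R' → R₀ σ = R' := by
    intro σ hσ c' R' h
    exact ((hS₀ σ hσ).le (hKne σ hσ) h.1).antisymm (h.le (hKne σ hσ) (hS₀ σ hσ).1)
  have htoggle : ∀ σ ∈ K \ L, ∀ υ, υ = insert (u σ) σ ∨ υ = σ.erase (u σ) →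
      υ ∈ K \ L ∧ below υ = below σ ∧ R υ = R σ ∧ R₀ υ = R₀ σ := by
    intro σ hσ υ hυ
    have hσK := hσ.1
    have hσne := hKne σ hσK
    obtain ⟨h1, h2, h3⟩ := (mem_delCech_diff_del_iff hγ hσne (hS σ hσK) (hS₀ σ hσK)).1 hσ
    obtain ⟨w, hw, hwu, hdist⟩ : ∃ w, IsCenterCombo x (c σ) (R σ) w ∧ w (u σ) < 0 ∧
        dist (x (u σ)) (c₀ σ) < R₀ σ :=
      Classical.epsilon_spec
        ((hS σ hσK).exists_neg_and_dist_lt hσne (hS₀ σ hσK).1 (h1.trans_lt h2))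
    have hub : u σ ∈ below σ := by
      obtain ⟨-, w', hw', -, hneg⟩ := hS σ hσK
      exact hneg _ (hw.unique hinj hgp hw' ▸ hwu)
    have hE := (hS σ hσK).insert_erase hinj hgp hw hwu.le (hw.dist_eq _ hwu.ne).le
    have h0 := (hS₀ σ hσK).insert_erase_of_dist_lt hinj hgp hdist
    have hbel : below υ = below σ := by
      rcases hυ with rfl | rfl
      · exact below_insert hub
      · exact below_erase hub
    have hυE : IsMinSphere x υ (below υ) (c σ) (R σ) := by
      rw [hbel]
      rcases hυ with rfl | rfl
      · exact hE.1
      · exact hE.2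
    have hυ0 : IsMinSphere x υ ∅ (c₀ σ) (R₀ σ) := by
      rcases hυ with rfl | rfl
      · exact h0.1
      · exact h0.2
    have hυne : υ.Nonempty := by
      rcases hυ with rfl | rfl
      · exact Finset.insert_nonempty _ _
      · exact erase_nonempty_of_mem_below hub
    have hυγ : ∀ i ∈ υ, γ i ≤ s := by
      intro i hi
      rcases hυ with rfl | rfl
      · rcases Finset.mem_insert.1 hi with rfl | hi
        · obtain ⟨j, hj, hij⟩ := mem_below.1 hub
          exact (hγ hij.le).trans (h3 j hj)
        · exact h3 i hi
      · exact h3 i (Finset.mem_of_mem_erase hi)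
    have hυKL : υ ∈ K \ L := (mem_delCech_diff_del_iff hγ hυne hυE hυ0).2 ⟨h1, h2, hυγ⟩
    exact ⟨hυKL, hbel, huniq υ hυKL.1 hυE, huniq₀ υ hυKL.1 hυ0⟩
  refine collapsesTo_of_matching (fun σ => (below σ).card + R σ + R₀ σ) u K hLK
    (fun σ hσ υ hυ hsub => DelBiMem.of_subset hγ hυ (hKne σ hσ) hsub) ?_ ?_ ?_
  · intro σ hσ υ hυ hsub
    have hσne := hKne σ hσ.1
    have hsep := (hS υ hυ.1).1.mono hsub (below_mono hsub)
    have hsep₀ := (hS₀ υ hυ.1).1.mono hsub subset_rfl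
    have h1 : ((below σ).card : ℝ) ≤ (below υ).card := by
      exact_mod_cast Finset.card_le_card (below_mono hsub)
    have h2 := (hS σ hσ.1).le hσne hsep
    have h3 := (hS₀ σ hσ.1).le hσne hsep₀
    refine ⟨by linarith, fun heq => ?_⟩
    have hR : R υ = R σ := by linarith
    have hR₀ : R₀ υ = R₀ σ := by linarith
    have hc : c σ = c υ := (hS σ hσ.1).center_eq hσne (hR ▸ hsep)
    have hc₀ : c₀ σ = c₀ υ := (hS₀ σ hσ.1).center_eq hσne (hR₀ ▸ hsep₀)
    simp only [u, hR, hR₀, hc, hc₀]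
  · intro σ hσ
    obtain ⟨h1, h2, h3, h4⟩ := htoggle σ hσ _ (Or.inl rfl)
    exact ⟨h1, by simp only [h2, h3, h4]⟩
  · intro σ hσ
    obtain ⟨h1, h2, h3, h4⟩ := htoggle σ hσ _ (Or.inr rfl)
    exact ⟨h1, by simp only [h2, h3, h4]⟩

/-- The sublevel Delaunay–Čech complex collapses to the sublevel Delaunay complex:
`DelČech_{r,s}(γ) ↘ Del_{r,s}(γ)`; in particular, the inclusion of geometric realizations
`|Del_{r,s}(γ)| ↪ |DelČech_{r,s}(γ)|` is a homotopy equivalence. -/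
theorem delCech_collapses_to_del (x : Fin n → EuclideanSpace ℝ (Fin d))
    (hinj : Function.Injective x) (hgp : GenPos x)
    (γ : Fin n → ℝ) (hγ : Monotone γ) (r s : ℝ) (hr : 0 ≤ r) :
    CollapsesTo {σ | DelCechBiMem x γ r s σ} {σ | DelBiMem x γ r s σ} ∧
    ∃ hsub : spaceOf {σ | DelBiMem x γ r s σ} ⊆ spaceOf {σ | DelCechBiMem x γ r s σ},
      ∃ g : C(spaceOf {σ | DelCechBiMem x γ r s σ}, spaceOf {σ | DelBiMem x γ r s σ}),
        (ContinuousMap.Homotopic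
          (((⟨Set.inclusion hsub, continuous_inclusion hsub⟩ :
              C(spaceOf {σ | DelBiMem x γ r s σ},
                spaceOf {σ | DelCechBiMem x γ r s σ}))).comp g)
          (ContinuousMap.id _)) ∧
        (ContinuousMap.Homotopic
          (g.comp (⟨Set.inclusion hsub, continuous_inclusion hsub⟩ :
              C(spaceOf {σ | DelBiMem x γ r s σ},
                spaceOf {σ | DelCechBiMem x γ r s σ})))
          (ContinuousMap.id _)) := by
  have hcollapse := collapsesTo_delCech_del hinj hgp hγ r s
  obtain ⟨hsub, e, he⟩ := hcollapse.inclusionHomotopyEquiv (isComplex_delCech hγ)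
  exact ⟨hcollapse, hsub, e.invFun, he ▸ e.right_inv, he ▸ e.left_inv⟩
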